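/- Let Φ = (A; {E_i}_{i=0}^d; A*; {E*_i}_{i=0}^d) be a CH system on V, and let {u_i}_{i=0}^d be vectors in V, not all zero. Then there exists a nonzero vector u* ∈ E*_0V such that u_i = E_i u* for 0 ≤ i ≤ d if and only if both: (i) u_i ∈ E_iV for 0 ≤ i ≤ d, and (ii) ∑_{i=0}^d u_i ∈ E*_0V. -/

import Mathlib

open Polynomial Finset Module

variable {F V : Type*} [Field F] [AddCommGroup V] [Module F V]

/-- The primitive idempotent of `A` for the eigenvalue `θ i`, where the eigenvalues of `A`
are `θ 0, …, θ d`. -/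
noncomputable def primIdem (d : ℕ) (A : Module.End F V) (θ : ℕ → F) (i : ℕ) :
    Module.End F V :=
  Polynomial.aeval A (∏ j ∈ (Finset.range (d+1)).erase i,
    (Polynomial.C (θ i - θ j)⁻¹ * (Polynomial.X - Polynomial.C (θ j))))

/-- A sequence `σ 0, …, σ n` is `β`-recurrent. -/
def BetaRecurrent (β : F) (n : ℕ) (σ : ℕ → F) : Prop :=
  ∀ i, 2 ≤ i → i + 1 ≤ n → σ (i-2) - (β+1) * σ (i-1) + (β+1) * σ i - σ (i+1) = 0

/-- The scalars ϑ_i attached to eigenvalue data `θ, θs` and a split sequence `φ`: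
`ϑ 0 = 0`, `ϑ (d+1) = 0` and `ϑ i = φ i - (θs i - θs 0)(θ (d-i+1) - θ 0)` for `1 ≤ i ≤ d`. -/
def vth (d : ℕ) (θ θs φ : ℕ → F) (i : ℕ) : F :=
  if 1 ≤ i ∧ i ≤ d then φ i - (θs i - θs 0) * (θ (d - i + 1) - θ 0) else 0

/-- `φ 1, …, φ d` is the split sequence for `(A, As)` with eigenvalue data `θ, θs`:
there is a (split) basis `v 0, …, v d` of `V` on which `A, As` act in the prescribed way. -/
def SplitSeq (d : ℕ) (A As : Module.End F V) (θ θs φ : ℕ → F) : Prop :=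
  ∃ v : ℕ → V,
    LinearIndependent F (fun i : Fin (d+1) => v i) ∧
    Submodule.span F (v '' Set.Iic d) = ⊤ ∧
    (∀ i < d, A (v i) = θ (d - i) • v i + v (i+1)) ∧
    A (v d) = θ 0 • v d ∧
    As (v 0) = θs 0 • v 0 ∧
    (∀ i, 1 ≤ i → i ≤ d → As (v i) = θs i • v i + φ i • v (i-1))

/-- A circular Hessenberg system on `V` of diameter `d`. -/
structure CHSystem (F V : Type*) [Field F] [AddCommGroup V] [Module F V] (d : ℕ) where
  A : Module.End F V
  As : Module.End F V
  θ : ℕ → F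
  θs : ℕ → F
  θ_inj : ∀ i ≤ d, ∀ j ≤ d, θ i = θ j → i = j
  θs_inj : ∀ i ≤ d, ∀ j ≤ d, θs i = θs j → i = j
  A_ann : Polynomial.aeval A (∏ j ∈ Finset.range (d+1), (Polynomial.X - Polynomial.C (θ j))) = 0
  As_ann : Polynomial.aeval As (∏ j ∈ Finset.range (d+1), (Polynomial.X - Polynomial.C (θs j))) = 0
  A_eig : ∀ i ≤ d, Module.End.HasEigenvalue A (θ i)
  As_eig : ∀ i ≤ d, Module.End.HasEigenvalue As (θs i)
  circ₁ : ∀ i ≤ d, ∀ j ≤ d, ((j:ℤ) + 1 < (i:ℤ) ∨ (1 < (j:ℤ) - (i:ℤ) ∧ (j:ℤ) - (i:ℤ) < (d:ℤ))) →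
      primIdem d A θ i * As * primIdem d A θ j = 0
  circ₂ : ∀ i ≤ d, ∀ j ≤ d, ((i:ℤ) = (j:ℤ) + 1 ∨ (j:ℤ) = (i:ℤ) + (d:ℤ)) →
      primIdem d A θ i * As * primIdem d A θ j ≠ 0
  circ₃ : ∀ i ≤ d, ∀ j ≤ d, ((j:ℤ) + 1 < (i:ℤ) ∨ (1 < (j:ℤ) - (i:ℤ) ∧ (j:ℤ) - (i:ℤ) < (d:ℤ))) →
      primIdem d As θs i * A * primIdem d As θs j = 0
  circ₄ : ∀ i ≤ d, ∀ j ≤ d, ((i:ℤ) = (j:ℤ) + 1 ∨ (j:ℤ) = (i:ℤ) + (d:ℤ)) →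
      primIdem d As θs i * A * primIdem d As θs j ≠ 0

section PrimitiveIdempotents

variable {d : ℕ} {A : Module.End F V} {θ : ℕ → F}

theorem primIdem_eq_aeval_basis (d : ℕ) (A : Module.End F V) (θ : ℕ → F) (i : ℕ) :
    primIdem d A θ i = Polynomial.aeval A (Lagrange.basis (Finset.range (d + 1)) θ i) :=
  rfl

theorem sum_primIdem (hθ : ∀ i ≤ d, ∀ j ≤ d, θ i = θ j → i = j) :
    ∑ i ∈ Finset.range (d + 1), primIdem d A θ i = 1 := by
  have hinj : Set.InjOn θ (Finset.range (d + 1) : Finset ℕ) := by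
    intro i hi j hj h
    simp only [Finset.coe_range, Set.mem_Iio, Nat.lt_succ_iff] at hi hj
    exact hθ i hi j hj h
  simp only [primIdem_eq_aeval_basis]
  rw [← map_sum, Lagrange.sum_basis hinj ⟨0, by simp⟩, map_one]

theorem primIdem_mul_primIdem_of_ne
    (hA : Polynomial.aeval A (∏ j ∈ Finset.range (d + 1), (X - C (θ j))) = 0)
    {i j : ℕ} (hj : j ≤ d) (hij : i ≠ j) :
    primIdem d A θ i * primIdem d A θ j = 0 := by
  have hjmem : j ∈ Finset.range (d + 1) := Finset.mem_range.2 (Nat.lt_succ_of_le hj)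
  have hi : X - C (θ j) ∣ Lagrange.basis (Finset.range (d + 1)) θ i :=
    (Dvd.intro_left _ rfl).trans
      (Finset.dvd_prod_of_mem (fun k => Lagrange.basisDivisor (θ i) (θ k))
        (Finset.mem_erase.2 ⟨hij.symm, hjmem⟩))
  have hj' : ∏ k ∈ (Finset.range (d + 1)).erase j, (X - C (θ k)) ∣
      Lagrange.basis (Finset.range (d + 1)) θ j :=
    Finset.prod_dvd_prod_of_dvd _ _ fun _ _ => Dvd.intro_left _ rfl
  obtain ⟨q, hq⟩ := mul_dvd_mul hi hj'
  rw [Finset.mul_prod_erase _ (fun k => X - C (θ k)) hjmem] at hq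
  rw [primIdem_eq_aeval_basis, primIdem_eq_aeval_basis, ← map_mul, hq, map_mul, hA, zero_mul]

theorem primIdem_sum_of_mem_range (hθ : ∀ i ≤ d, ∀ j ≤ d, θ i = θ j → i = j)
    (hA : Polynomial.aeval A (∏ j ∈ Finset.range (d + 1), (X - C (θ j))) = 0)
    {u : ℕ → V} (hu : ∀ i ≤ d, u i ∈ LinearMap.range (primIdem d A θ i)) {i : ℕ} (hi : i ≤ d) :
    primIdem d A θ i (∑ j ∈ Finset.range (d + 1), u j) = u i := by
  have hzero : ∀ k j, j ≤ d → k ≠ j → primIdem d A θ k (u j) = 0 := by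
    intro k j hj hkj
    obtain ⟨w, hw⟩ := hu j hj
    rw [← hw, ← Module.End.mul_apply, primIdem_mul_primIdem_of_ne hA hj hkj,
      LinearMap.zero_apply]
  have himem : i ∈ Finset.range (d + 1) := Finset.mem_range.2 (Nat.lt_succ_of_le hi)
  have hfix : primIdem d A θ i (u i) = u i := by
    have h := congrArg (fun T : Module.End F V => T (u i)) (sum_primIdem (A := A) hθ)
    simp only [LinearMap.sum_apply, Module.End.one_apply] at h
    rwa [Finset.sum_eq_single_of_mem i himem fun k _ hk => hzero k i hi hk] at h
  rw [map_sum, Finset.sum_eq_single_of_mem i himem, hfix]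
  intro j hj hji
  exact hzero i j (Nat.lt_succ_iff.1 (Finset.mem_range.1 hj)) hji.symm

end PrimitiveIdempotents

/-- characterization of the `Φ`-standard basis. -/
theorem stmt12 {F V : Type*} [Field F] [AddCommGroup V] [Module F V]
    (d : ℕ) (hd : 3 ≤ d) (hdim : Module.finrank F V = d + 1)
    (Φ : CHSystem F V d)
    (u : ℕ → V) (hnz : ∃ i ≤ d, u i ≠ 0) :
    (∃ ustar : V, ustar ≠ 0 ∧ ustar ∈ LinearMap.range (primIdem d Φ.As Φ.θs 0) ∧
      ∀ i ≤ d, u i = primIdem d Φ.A Φ.θ i ustar) ↔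
    ((∀ i ≤ d, u i ∈ LinearMap.range (primIdem d Φ.A Φ.θ i)) ∧
      (∑ i ∈ Finset.range (d+1), u i) ∈ LinearMap.range (primIdem d Φ.As Φ.θs 0)) := by
  constructor
  · rintro ⟨w, -, hw, hu⟩
    refine ⟨fun i hi => ⟨w, (hu i hi).symm⟩, ?_⟩
    have hsum : ∑ i ∈ Finset.range (d + 1), u i = w := by
      rw [Finset.sum_congr rfl fun i hi =>
        hu i (Nat.lt_succ_iff.1 (Finset.mem_range.1 hi)), ← LinearMap.sum_apply,
        sum_primIdem Φ.θ_inj, Module.End.one_apply]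
    rwa [hsum]
  · rintro ⟨hu, hsum⟩
    have hE := fun i (hi : i ≤ d) => primIdem_sum_of_mem_range Φ.θ_inj Φ.A_ann hu hi
    refine ⟨_, ?_, hsum, fun i hi => (hE i hi).symm⟩
    intro h0
    obtain ⟨i, hi, hui⟩ := hnz
    exact hui (by rw [← hE i hi, h0, map_zero])
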